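/- Let H > 0, ε > 0, and let D = ×_{i=1}^n D_i where each D_i is an arbitrary probability distribution supported on [0,H]. Then there exists a single-item mechanism M*, depending only on D and ε, that is DSIC and IR, such that for every product distribution D̂ = ×_{i=1}^n D̂_i with ‖D_i − D̂_i‖_L ≤ ε for every i, the revenue satisfies Rev(M*, D̂) ≥ OPT(D̂) − (6nH + 3nε + 2)·ε. -/

import Mathlib

open MeasureTheory Set

namespace SingleItem

/-- A single-item mechanism for `n` bidders: (expected) allocation probabilities and
(expected) payments on each bid profile. -/
structure Mech (n : ℕ) where
  alloc : (Fin n → ℝ) → Fin n → ℝ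
  pay : (Fin n → ℝ) → Fin n → ℝ
  alloc_nonneg : ∀ b i, 0 ≤ alloc b i
  alloc_sum_le_one : ∀ b, ∑ i, alloc b i ≤ 1
  meas_alloc : ∀ i, Measurable fun b => alloc b i
  meas_pay : ∀ i, Measurable fun b => pay b i

/-- Utility of bidder `i` with value `vi` when the bid profile is `b`. -/
def util {n : ℕ} (M : Mech n) (i : Fin n) (vi : ℝ) (b : Fin n → ℝ) : ℝ :=
  vi * M.alloc b i - M.pay b i

/-- Dominant-strategy incentive compatibility. -/
def DSIC {n : ℕ} (M : Mech n) : Prop :=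
  ∀ (i : Fin n) (v : Fin n → ℝ) (v' : ℝ),
    util M i (v i) (Function.update v i v') ≤ util M i (v i) v

/-- (Ex-post) individual rationality. -/
def IR {n : ℕ} (M : Mech n) : Prop :=
  ∀ (i : Fin n) (v : Fin n → ℝ), 0 ≤ util M i (v i) v

/-- Expected revenue of a mechanism under (truthful) bids drawn from `D`. -/
noncomputable def Rev {n : ℕ} (M : Mech n) (D : Measure (Fin n → ℝ)) : ℝ :=
  ∫ b, (∑ i, M.pay b i) ∂D

/-- Optimal revenue over DSIC and IR mechanisms. -/
noncomputable def OPT {n : ℕ} (D : Measure (Fin n → ℝ)) : ℝ :=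
  sSup {r | ∃ M : Mech n, DSIC M ∧ IR M ∧ r = Rev M D}

/-- The Lévy distance between `P` and `Q` is at most `ε`. -/
def LevyLe (P Q : Measure ℝ) (ε : ℝ) : Prop :=
  ∀ x : ℝ, (P (Iic (x - ε))).toReal - ε ≤ (Q (Iic x)).toReal ∧
    (Q (Iic x)).toReal ≤ (P (Iic (x + ε))).toReal + ε

/-- The Kolmogorov distance between `P` and `Q` is at most `ε`. -/
def KolmogorovLe (P Q : Measure ℝ) (ε : ℝ) : Prop :=
  ∀ x : ℝ, |(P (Iic x)).toReal - (Q (Iic x)).toReal| ≤ ε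

end SingleItem

open SingleItem

namespace Robust

open Finset in
/-- The ironed (concave) revenue curve on `{0,…,N}`. -/
theorem iron (N : ℕ) (v : ℕ → ℝ) (H : ℝ) (hv0 : ∀ k, 0 ≤ v k) (hvH : ∀ k, v k ≤ H) :
    ∃ G : ℕ → ℝ, G N = 0 ∧ (∀ k ≤ N, v k * ((N : ℝ) - k) ≤ G k) ∧
      (∀ k, k + 2 ≤ N → G k + G (k + 2) ≤ 2 * G (k + 1)) ∧
      G 0 = v 0 * N ∧
      (∀ k, k + 2 ≤ N → G k - G (k + 1) < G (k + 1) - G (k + 2) →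
        G (k + 1) = v (k + 1) * ((N : ℝ) - (k + 1 : ℕ))) := by
  classical
  set R : ℕ → ℝ := fun k => v k * ((N : ℝ) - k) with hR
  set C : Set (ℕ → ℝ) := {g | (∀ k ≤ N, R k ≤ g k) ∧
    (∀ k, k + 2 ≤ N → g k + g (k + 2) ≤ 2 * g (k + 1))} with hC
  set G : ℕ → ℝ := fun k => sInf ((fun g : ℕ → ℝ => g k) '' C) with hG
  have hCne : C.Nonempty := by
    refine ⟨fun _ => H * N, ?_, ?_⟩
    · intro k hk
      have hk' : (k : ℝ) ≤ N := by exact_mod_cast hk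
      have h0 : (0 : ℝ) ≤ k := by positivity
      simp only [hR]
      nlinarith [hv0 k, hvH k]
    · intro k _; simp only; linarith
  have hbdd : ∀ k ≤ N, BddBelow ((fun g : ℕ → ℝ => g k) '' C) := by
    intro k hk
    refine ⟨R k, ?_⟩
    rintro _ ⟨g, hg, rfl⟩
    exact hg.1 k hk
  have hGle : ∀ k ≤ N, ∀ g ∈ C, G k ≤ g k := fun k hk g hg =>
    csInf_le (hbdd k hk) ⟨g, hg, rfl⟩
  have hleG : ∀ k, ∀ y, (∀ g ∈ C, y ≤ g k) → y ≤ G k := by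
    intro k y hy
    refine le_csInf (hCne.image _) ?_
    rintro _ ⟨g, hg, rfl⟩
    exact hy g hg
  have hGC : G ∈ C := by
    refine ⟨fun k hk => hleG k _ fun g hg => hg.1 k hk, fun k hk => ?_⟩
    have : (G k + G (k + 2)) / 2 ≤ G (k + 1) := by
      refine hleG _ _ fun g hg => ?_
      have h1 := hGle k (by omega) g hg
      have h2 := hGle (k + 2) (by omega) g hg
      have h3 := hg.2 k hk
      linarith
    linarith
  have key : ∀ k ≤ N, ∀ y, R k ≤ y → y ≤ G k →
      (∀ j, j + 1 = k → j + 2 ≤ N → G j + G (j + 2) ≤ 2 * y) → G k = y := by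
    intro k hk y hy1 hy2 hy3
    refine le_antisymm ?_ hy2
    have hmem : Function.update G k y ∈ C := by
      refine ⟨fun j hj => ?_, fun j hj => ?_⟩
      · by_cases h : j = k
        · subst h; simpa using hy1
        · simpa [Function.update_of_ne h] using hGC.1 j hj
      · have hle : ∀ l, Function.update G k y l ≤ G l := by
          intro l
          by_cases h : l = k
          · subst h; simpa using hy2
          · simp [Function.update_of_ne h]
        by_cases h : j + 1 = k
        · have := hy3 j h hj
          have e : Function.update G k y (j + 1) = y := by rw [h]; simp
          rw [e]
          linarith [hle j, hle (j + 2)]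
        · rw [Function.update_of_ne h]
          linarith [hle j, hle (j + 2), hGC.2 j hj]
    have := hGle k hk _ hmem
    simpa using this
  refine ⟨G, ?_, hGC.1, hGC.2, ?_, ?_⟩
  · have := key N le_rfl (R N) le_rfl (hGC.1 N le_rfl) (by intro j h1 h2; omega)
    rw [this]; simp [hR]
  · have := key 0 (Nat.zero_le _) (R 0) le_rfl (hGC.1 0 (Nat.zero_le _)) (by intro j h1 h2; omega)
    rw [this]; simp [hR]
  · intro k hk hlt
    by_contra hne
    have h1 := hGC.1 (k + 1) (by omega)
    have h2 : R (k + 1) < G (k + 1) := lt_of_le_of_ne h1 (fun h => hne h.symm)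
    have := key (k + 1) (by omega) (max (R (k + 1)) ((G k + G (k + 2)) / 2)) (le_max_left _ _)
      (max_le h1 (by linarith)) (by
        intro j hj _
        obtain rfl : j = k := by omega
        linarith [le_max_right (R (j + 1)) ((G j + G (j + 2)) / 2)])
    have h3 : max (R (k + 1)) ((G k + G (k + 2)) / 2) < G (k + 1) := max_lt h2 (by linarith)
    linarith

/-- One-bidder revenue bound by ironed virtual surplus. -/
theorem one_bidder (N m s : ℕ) (hms : m + s = N) (v w x p G : ℕ → ℝ) (η : ℝ)
    (hw : ∀ a < m, w a ≤ v (a + s) + η)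
    (hIR : p 0 ≤ w 0 * x 0) (hIC : ∀ a, p (a + 1) - p a ≤ w (a + 1) * (x (a + 1) - x a))
    (hx0 : 0 ≤ x 0) (hx : ∀ a, x a ≤ x (a + 1))
    (hGR : ∀ k ≤ N, v k * ((N : ℝ) - k) ≤ G k) (hGN : G N = 0) :
    ∑ a ∈ Finset.range m, p a ≤
      ∑ a ∈ Finset.range m, (G (a + s) - G (a + s + 1) + η) * x a := by
  have hN : (m : ℝ) + s = N := by exact_mod_cast hms
  have key : ∀ j, j + 1 ≤ m → ∑ a ∈ Finset.range (j + 1), (p a - η * x a) +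
      ((m : ℝ) - (j + 1)) * (p j - η * x j) ≤
      ∑ a ∈ Finset.range (j + 1), (G (a + s) - G (a + s + 1)) * x a + G (j + 1 + s) * x j := by
    intro j
    induction j with
    | zero =>
      intro hj
      have h1 := hw 0 (by omega)
      have h2 := hGR s (by omega)
      have hm : (1 : ℝ) ≤ m := by exact_mod_cast hj
      simp only [zero_add, Finset.sum_range_one] at *
      have h3 : p 0 - η * x 0 ≤ v s * x 0 := by nlinarith
      have h4 : (N : ℝ) - s = m := by linarith
      rw [h4] at h2
      have h5 : (m : ℝ) * (p 0 - η * x 0) ≤ m * (v s * x 0) := by gcongr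
      have h6 : v s * m * x 0 ≤ G s * x 0 := by gcongr
      have e : s + 1 = 1 + s := by ring
      rw [e]
      push_cast
      nlinarith
    | succ j ih =>
      intro hj
      have ih := ih (by omega)
      rw [Finset.sum_range_succ (n := j + 1), Finset.sum_range_succ (n := j + 1)]
      have h1 := hw (j + 1) (by omega)
      have h2 := hGR (j + 1 + s) (by omega)
      have hm : ((j : ℝ) + 1) + 1 ≤ m := by exact_mod_cast hj
      have hd : 0 ≤ x (j + 1) - x j := by linarith [hx j]
      have h3 : (p (j + 1) - η * x (j + 1)) - (p j - η * x j) ≤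
          v (j + 1 + s) * (x (j + 1) - x j) := by
        have := hIC j
        nlinarith
      push_cast at h2 ⊢
      have h4 : (N : ℝ) - (j + 1 + s) = m - (j + 1) := by linarith
      rw [h4] at h2
      have h0 : (0 : ℝ) ≤ m - (j + 1) := by linarith
      have h5 := mul_le_mul_of_nonneg_left h3 h0
      have h6 := mul_le_mul_of_nonneg_right h2 hd
      have e : j + 1 + s + 1 = j + 1 + 1 + s := by ring
      rw [e]
      nlinarith
  have expand : ∑ a ∈ Finset.range m, (G (a + s) - G (a + s + 1) + η) * x a =
      ∑ a ∈ Finset.range m, (G (a + s) - G (a + s + 1)) * x a +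
      ∑ a ∈ Finset.range m, η * x a := by
    rw [← Finset.sum_add_distrib]
    exact Finset.sum_congr rfl fun a _ => by ring
  rcases Nat.eq_zero_or_pos m with h0 | hpos
  · subst h0; simp
  · obtain ⟨j, rfl⟩ : ∃ j, m = j + 1 := ⟨m - 1, by omega⟩
    have := key j le_rfl
    rw [hms, hGN, Finset.sum_sub_distrib] at this
    rw [expand]
    push_cast at this
    linarith

/-- The index cube. -/
abbrev cube (n N : ℕ) : Finset (Fin n → ℕ) := Fintype.piFinset fun _ => Finset.range N

theorem sum_update (n N : ℕ) (i : Fin n) (F : (Fin n → ℕ) → ℝ) :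
    ∑ k ∈ cube n N, ∑ a ∈ Finset.range N, F (Function.update k i a) =
      N * ∑ k ∈ cube n N, F k := by
  have h : ∑ k ∈ cube n N, ∑ a ∈ Finset.range N, F (Function.update k i a) =
      ∑ k ∈ cube n N, ∑ _a ∈ Finset.range N, F k := by
    rw [← Finset.sum_product', ← Finset.sum_product']
    refine Finset.sum_nbij' (fun q => (Function.update q.1 i q.2, q.1 i))
      (fun q => (Function.update q.1 i q.2, q.1 i)) ?_ ?_ ?_ ?_ ?_
    all_goals
      rintro ⟨k, a⟩ hka
      simp only [Finset.mem_product, Fintype.mem_piFinset, Finset.mem_range] at hka ⊢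
    · refine ⟨fun j => ?_, hka.1 i⟩
      by_cases h : j = i
      · subst h; simpa using hka.2
      · simpa [Function.update_of_ne h] using hka.1 j
    · refine ⟨fun j => ?_, hka.1 i⟩
      by_cases h : j = i
      · subst h; simpa using hka.2
      · simpa [Function.update_of_ne h] using hka.1 j
    · simp
    · simp
  rw [h]
  simp [Finset.mul_sum]

theorem sum_le_of_update (n N : ℕ) (hN : 0 < N) (i : Fin n) (F F' : (Fin n → ℕ) → ℝ)
    (h : ∀ k ∈ cube n N, ∑ a ∈ Finset.range N, F (Function.update k i a) ≤
      ∑ a ∈ Finset.range N, F' (Function.update k i a)) :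
    ∑ k ∈ cube n N, F k ≤ ∑ k ∈ cube n N, F' k := by
  have h1 := Finset.sum_le_sum h
  rw [sum_update, sum_update] at h1
  exact le_of_mul_le_mul_left h1 (by exact_mod_cast hN)

open scoped NNReal

/-- Positive part of the virtual value associated with a bid. -/
noncomputable def psi (N : ℕ) (v φ : ℕ → ℝ) (b : ℝ) : ℝ≥0 :=
  ((Finset.range N).filter (fun k => v k ≤ b)).sup (fun k => (φ k).toNNReal)

theorem psi_mono (N : ℕ) (v φ : ℕ → ℝ) : Monotone (psi N v φ) := by
  intro b b' h
  refine Finset.sup_mono ?_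
  intro k hk
  simp only [Finset.mem_filter] at hk ⊢
  exact ⟨hk.1, hk.2.trans h⟩

theorem le_psi {N : ℕ} {v φ : ℕ → ℝ} {b : ℝ} {k : ℕ} (hk : k < N) (h : v k ≤ b) :
    (φ k).toNNReal ≤ psi N v φ b :=
  Finset.le_sup (f := fun k => (φ k).toNNReal) (by simp [hk, h])

theorem exists_psi {N : ℕ} {v φ : ℕ → ℝ} {b : ℝ} (h : 0 < psi N v φ b) :
    ∃ k < N, v k ≤ b ∧ psi N v φ b = (φ k).toNNReal := by
  have hne : ((Finset.range N).filter (fun k => v k ≤ b)).Nonempty := by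
    by_contra hne
    rw [Finset.not_nonempty_iff_eq_empty] at hne
    simp [psi, hne] at h
  obtain ⟨k, hk, e⟩ := Finset.exists_mem_eq_sup _ hne (fun k => (φ k).toNNReal)
  simp only [Finset.mem_filter, Finset.mem_range] at hk
  exact ⟨k, hk.1, hk.2, e⟩

/-- Virtual value `c` of bidder `i` beats the other bidders of the profile `b`. -/
def Beats {n : ℕ} (N : ℕ) (v φ : Fin n → ℕ → ℝ) (i : Fin n) (c : ℝ≥0) (b : Fin n → ℝ) : Prop :=
  0 < c ∧ ∀ j, (j < i → psi N (v j) (φ j) (b j) < c) ∧ (i < j → psi N (v j) (φ j) (b j) ≤ c)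

/-- `a` is the least winning index of bidder `i`. -/
def Lst {n : ℕ} (N : ℕ) (v φ : Fin n → ℕ → ℝ) (i : Fin n) (a : ℕ) (b : Fin n → ℝ) : Prop :=
  Beats N v φ i (φ i a).toNNReal b ∧ ∀ a' < a, ¬ Beats N v φ i (φ i a').toNNReal b

theorem beats_update {n N : ℕ} {v φ : Fin n → ℕ → ℝ} {i : Fin n} {c : ℝ≥0} {b : Fin n → ℝ}
    {x : ℝ} : Beats N v φ i c (Function.update b i x) ↔ Beats N v φ i c b := by
  unfold Beats
  refine and_congr Iff.rfl (forall_congr' fun j => ?_)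
  by_cases h : j = i
  · subst h; simp
  · rw [Function.update_of_ne h]

theorem lst_update {n N : ℕ} {v φ : Fin n → ℕ → ℝ} {i : Fin n} {a : ℕ} {b : Fin n → ℝ}
    {x : ℝ} : Lst N v φ i a (Function.update b i x) ↔ Lst N v φ i a b := by
  unfold Lst
  simp only [beats_update]

theorem Beats.mono {n N : ℕ} {v φ : Fin n → ℕ → ℝ} {i : Fin n} {c c' : ℝ≥0} {b : Fin n → ℝ}
    (h : Beats N v φ i c b) (hc : c ≤ c') : Beats N v φ i c' b :=
  ⟨h.1.trans_le hc, fun j => ⟨fun hj => ((h.2 j).1 hj).trans_le hc,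
    fun hj => ((h.2 j).2 hj).trans hc⟩⟩

theorem Beats.psi_le {n N : ℕ} {v φ : Fin n → ℕ → ℝ} {i : Fin n} {c : ℝ≥0} {b : Fin n → ℝ}
    (h : Beats N v φ i c b) {j : Fin n} (hj : j ≠ i) : psi N (v j) (φ j) (b j) ≤ c := by
  rcases lt_or_gt_of_ne hj with h' | h'
  · exact ((h.2 j).1 h').le
  · exact (h.2 j).2 h'

theorem lst_unique {n N : ℕ} {v φ : Fin n → ℕ → ℝ} {i j : Fin n} {a a' : ℕ} {b : Fin n → ℝ}
    (ha : a < N) (ha' : a' < N)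
    (h : Lst N v φ i a b) (hv : v i a ≤ b i) (h' : Lst N v φ j a' b) (hv' : v j a' ≤ b j) :
    i = j ∧ a = a' := by
  have aux : ∀ {i j : Fin n} {a a' : ℕ}, a < N → a' < N → Lst N v φ i a b → v i a ≤ b i →
      Lst N v φ j a' b → v j a' ≤ b j → ¬ i < j := by
    intro i j a a' ha ha' h hv h' hv' hij
    have h1 := (h.1.2 j).2 hij
    have h2 := (h'.1.2 i).1 hij
    have h3 : (φ i a).toNNReal ≤ _ := le_psi (φ := φ i) ha hv
    have h4 : (φ j a').toNNReal ≤ _ := le_psi (φ := φ j) ha' hv'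
    exact absurd (h3.trans_lt (h2.trans_le (h4.trans h1))) (lt_irrefl _)
  have hij : i = j :=
    le_antisymm (not_lt.1 (aux ha' ha h' hv' h hv)) (not_lt.1 (aux ha ha' h hv h' hv'))
  subst hij
  refine ⟨rfl, ?_⟩
  rcases lt_trichotomy a a' with h1 | h1 | h1
  · exact absurd h.1 (h'.2 _ h1)
  · exact h1
  · exact absurd h'.1 (h.2 _ h1)

theorem meas_beats {n : ℕ} (N : ℕ) (v φ : Fin n → ℕ → ℝ) (i : Fin n) (c : ℝ≥0) :
    MeasurableSet {b | Beats N v φ i c b} := by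
  have hm : ∀ j, Measurable fun b : Fin n → ℝ => psi N (v j) (φ j) (b j) := fun j =>
    (psi_mono N (v j) (φ j)).measurable.comp (measurable_pi_apply j)
  refine measurableSet_setOfPred.2 ?_
  refine Measurable.and measurable_const (Measurable.forall fun j => Measurable.and
    (Measurable.imp measurable_const ?_) (Measurable.imp measurable_const ?_))
  · exact measurableSet_setOfPred.1 (measurableSet_lt (hm j) measurable_const)
  · exact measurableSet_setOfPred.1 (measurableSet_le (hm j) measurable_const)

theorem meas_lst {n : ℕ} (N : ℕ) (v φ : Fin n → ℕ → ℝ) (i : Fin n) (a : ℕ) :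
    MeasurableSet {b | Lst N v φ i a b ∧ v i a ≤ b i} := by
  refine measurableSet_setOfPred.2 ?_
  refine Measurable.and (Measurable.and (measurableSet_setOfPred.1 (meas_beats N v φ i _)) ?_)
    (measurableSet_setOfPred.1 (measurableSet_le measurable_const (measurable_pi_apply i)))
  exact Measurable.forall fun a' => Measurable.imp measurable_const
    (Measurable.not (measurableSet_setOfPred.1 (meas_beats N v φ i _)))

open Classical in
/-- The virtual-value auction. -/
noncomputable def myerson {n : ℕ} (N : ℕ) (v φ : Fin n → ℕ → ℝ) : Mech n where
  alloc b i := ∑ a ∈ Finset.range N, if (Lst N v φ i a b ∧ v i a ≤ b i) then 1 else 0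
  pay b i := ∑ a ∈ Finset.range N, if (Lst N v φ i a b ∧ v i a ≤ b i) then v i a else 0
  alloc_nonneg b i := Finset.sum_nonneg fun a _ => by split_ifs <;> norm_num
  alloc_sum_le_one b := by
    by_cases hex : ∃ i0, ∃ a0 < N, Lst N v φ i0 a0 b ∧ v i0 a0 ≤ b i0
    · obtain ⟨i0, a0, ha0, hl, hv⟩ := hex
      calc _ ≤ ∑ i, ∑ a ∈ Finset.range N, (if i = i0 then (if a = a0 then (1 : ℝ) else 0) else 0) := by
            refine Finset.sum_le_sum fun i _ => Finset.sum_le_sum fun a ha => ?_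
            by_cases h : Lst N v φ i a b ∧ v i a ≤ b i
            · obtain ⟨h1, h2⟩ := lst_unique (Finset.mem_range.1 ha) ha0 h.1 h.2 hl hv
              rw [if_pos h, if_pos h1, if_pos h2]
            · rw [if_neg h]; split_ifs <;> norm_num
        _ = 1 := by
            rw [Finset.sum_eq_single i0]
            · simp [ha0]
            · intro i _ hi; simp [hi]
            · simp
    · push Not at hex
      rw [Finset.sum_eq_zero]
      · norm_num
      · intro i _
        refine Finset.sum_eq_zero fun a ha => ?_
        rw [if_neg]
        rintro ⟨h1, h2⟩
        exact absurd h2 (not_le.2 (hex i a (Finset.mem_range.1 ha) h1))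
  meas_alloc i := Finset.measurable_sum _ fun a _ =>
    Measurable.ite (meas_lst N v φ i a) measurable_const measurable_const
  meas_pay i := Finset.measurable_sum _ fun a _ =>
    Measurable.ite (meas_lst N v φ i a) measurable_const measurable_const

open Classical in
theorem myerson_util {n : ℕ} (N : ℕ) (v φ : Fin n → ℕ → ℝ) (i : Fin n) (y : ℝ) (b : Fin n → ℝ) :
    util (myerson N v φ) i y b =
      ∑ a ∈ Finset.range N, if (Lst N v φ i a b ∧ v i a ≤ b i) then y - v i a else 0 := by
  simp only [util, myerson, Finset.mul_sum, ← Finset.sum_sub_distrib]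
  refine Finset.sum_congr rfl fun a _ => ?_
  split_ifs <;> ring

theorem myerson_DSIC {n : ℕ} (N : ℕ) (v φ : Fin n → ℕ → ℝ) : DSIC (myerson N v φ) := by
  intro i b y
  rw [myerson_util, myerson_util]
  refine Finset.sum_le_sum fun a _ => ?_
  by_cases h : Lst N v φ i a b
  · split_ifs with h1 h2 h2
    · exact le_rfl
    · have h3 := h1.2
      exact (sub_neg.2 (not_le.1 fun h4 => h2 ⟨h, h4⟩)).le
    · linarith [h2.2]
    · exact le_rfl
  · rw [if_neg (fun h1 => h (lst_update.1 h1.1)), if_neg (fun h1 => h h1.1)]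

theorem myerson_IR {n : ℕ} (N : ℕ) (v φ : Fin n → ℕ → ℝ) : IR (myerson N v φ) := by
  intro i b
  rw [myerson_util]
  refine Finset.sum_nonneg fun a _ => ?_
  split_ifs with h
  · linarith [h.2]
  · exact le_rfl

/-- Maximal positive virtual value. -/
noncomputable def VV {n : ℕ} (φ : Fin n → ℕ → ℝ) (k : Fin n → ℕ) : ℝ :=
  ((Finset.univ.sup fun i => (φ i (k i)).toNNReal : ℝ≥0) : ℝ)

theorem VV_nonneg {n : ℕ} (φ : Fin n → ℕ → ℝ) (k : Fin n → ℕ) : 0 ≤ VV φ k := NNReal.coe_nonneg _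

theorem le_VV {n : ℕ} (φ : Fin n → ℕ → ℝ) (k : Fin n → ℕ) (i : Fin n) : φ i (k i) ≤ VV φ k := by
  have h : (φ i (k i)).toNNReal ≤ (Finset.univ.sup fun i => (φ i (k i)).toNNReal : ℝ≥0) :=
    Finset.le_sup (f := fun i => (φ i (k i)).toNNReal) (Finset.mem_univ i)
  exact (Real.le_coe_toNNReal _).trans (by exact_mod_cast h)

open Classical in
/-- Lower bound used for the revenue from bidder `i`. -/
noncomputable def ZZ {n : ℕ} (N : ℕ) (v φ w : Fin n → ℕ → ℝ) (i : Fin n) (k : Fin n → ℕ) : ℝ :=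
  ∑ a ∈ Finset.range N, if Lst N v φ i a (fun j => w j (k j)) then
    (if a ≤ k i then φ i (k i) else if v i a ≤ w i (k i) then φ i a else 0) else 0

theorem VV_le_ZZ {n : ℕ} (N : ℕ) (v φ w : Fin n → ℕ → ℝ)
    (hφ : ∀ i, ∀ a b, a ≤ b → b < N → φ i a ≤ φ i b) (hv : ∀ i, Monotone (v i))
    (hvw : ∀ i, ∀ k < N, v i k ≤ w i k)
    (k : Fin n → ℕ) (hk : ∀ i, k i < N) :
    VV φ k ≤ ∑ i, ZZ N v φ w i k := by
  classical
  set b : Fin n → ℝ := fun j => w j (k j) with hb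
  have hpos : ∀ i a, Lst N v φ i a b → 0 < φ i a := fun i a h => by
    simpa using h.1.1
  have hterm : ∀ i a, 0 ≤ (if Lst N v φ i a b then
    (if a ≤ k i then φ i (k i) else if v i a ≤ w i (k i) then φ i a else 0) else 0) := by
    intro i a
    split_ifs with h1 h2 h3
    · exact (hpos i a h1).le.trans (hφ i a _ h2 (hk i))
    · exact (hpos i a h1).le
    · exact le_rfl
    · exact le_rfl
  have hZ0 : ∀ i, 0 ≤ ZZ N v φ w i k := fun i => Finset.sum_nonneg fun a _ => hterm i a
  rcases (VV_nonneg φ k).eq_or_lt with h0 | h0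
  · rw [← h0]; exact Finset.sum_nonneg fun i _ => hZ0 i
  have hVle : ∀ c : ℝ≥0, (∀ j, (φ j (k j)).toNNReal ≤ c) → VV φ k ≤ c := by
    intro c hc
    have : (Finset.univ.sup fun i => (φ i (k i)).toNNReal : ℝ≥0) ≤ c :=
      Finset.sup_le fun j _ => hc j
    exact_mod_cast this
  have hfp : ∀ j, (φ j (k j)).toNNReal ≤ psi N (v j) (φ j) (b j) := fun j =>
    le_psi (hk j) (hvw j _ (hk j))
  -- the winner
  have hne : (Finset.univ : Finset (Fin n)).Nonempty := by
    by_contra h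
    rw [Finset.not_nonempty_iff_eq_empty] at h
    simp [VV, h] at h0
  obtain ⟨i1, -, hi1⟩ := Finset.exists_max_image Finset.univ
    (fun j => psi N (v j) (φ j) (b j)) hne
  have hne2 : (Finset.univ.filter fun i => ∀ j, psi N (v j) (φ j) (b j) ≤
      psi N (v i) (φ i) (b i)).Nonempty :=
    ⟨i1, by simpa using fun j => hi1 j (Finset.mem_univ _)⟩
  obtain ⟨i, hi, himin⟩ := Finset.exists_min_image _ id hne2
  simp only [Finset.mem_filter, Finset.mem_univ, true_and, id] at hi himin
  have hpsi : 0 < psi N (v i) (φ i) (b i) := by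
    have := hVle _ (fun j => (hfp j).trans (hi j))
    have h2 := h0.trans_le this
    exact_mod_cast h2
  have hbeat : Beats N v φ i (psi N (v i) (φ i) (b i)) b := by
    refine ⟨hpsi, fun j => ⟨fun hj => ?_, fun _ => hi j⟩⟩
    by_contra hcon
    push Not at hcon
    exact absurd (himin j fun l => (hi l).trans hcon) (not_le.2 hj)
  obtain ⟨k', hk', hvk', hpk'⟩ := exists_psi hpsi
  have hex : ∃ a, Beats N v φ i (φ i a).toNNReal b := ⟨k', hpk' ▸ hbeat⟩
  obtain ⟨a, ha, hamin⟩ : ∃ a, Beats N v φ i (φ i a).toNNReal b ∧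
      ∀ a' < a, ¬ Beats N v φ i (φ i a').toNNReal b :=
    ⟨Nat.find hex, Nat.find_spec hex, fun a' h => Nat.find_min hex h⟩
  have hak' : a ≤ k' := by
    by_contra h
    exact hamin k' (not_le.1 h) (hpk' ▸ hbeat)
  have haN : a < N := hak'.trans_lt hk'
  have hlst : Lst N v φ i a b := ⟨ha, hamin⟩
  have hvab : v i a ≤ w i (k i) := (hv i hak').trans hvk'
  have hga : 0 < φ i a := hpos i a hlst
  refine le_trans ?_ (Finset.single_le_sum (fun i _ => hZ0 i) (Finset.mem_univ i))
  refine le_trans ?_ (Finset.single_le_sum (fun a _ => hterm i a) (Finset.mem_range.2 haN))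
  rw [if_pos hlst]
  have hoth : ∀ j, j ≠ i → (φ j (k j)).toNNReal ≤ (φ i a).toNNReal := fun j hj =>
    (hfp j).trans (ha.psi_le hj)
  by_cases hc : a ≤ k i
  · rw [if_pos hc]
    have h1 := hφ i a _ hc (hk i)
    have := hVle (φ i (k i)).toNNReal (fun j => by
      by_cases hj : j = i
      · subst hj; exact le_rfl
      · exact (hoth j hj).trans (Real.toNNReal_le_toNNReal h1))
    rwa [Real.coe_toNNReal _ (hga.le.trans h1)] at this
  · rw [if_neg hc, if_pos hvab]
    have := hVle (φ i a).toNNReal (fun j => by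
      by_cases hj : j = i
      · subst hj
        exact Real.toNNReal_le_toNNReal (hφ j _ _ (not_le.1 hc).le haN)
      · exact hoth j hj)
    rwa [Real.coe_toNNReal _ hga.le] at this

/-- All properties of ironed revenue curves that we use. -/
structure Ironed (N : ℕ) (v G : ℕ → ℝ) : Prop where
  last : G N = 0
  maj : ∀ k ≤ N, v k * ((N : ℝ) - k) ≤ G k
  conc : ∀ k, k + 2 ≤ N → G k + G (k + 2) ≤ 2 * G (k + 1)
  first : G 0 = v 0 * N
  contact : ∀ k, k + 2 ≤ N → G k - G (k + 1) < G (k + 1) - G (k + 2) →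
        G (k + 1) = v (k + 1) * ((N : ℝ) - (k + 1 : ℕ))

theorem Ironed.mono {N : ℕ} {v G : ℕ → ℝ} (h : Ironed N v G) (a b : ℕ) (hab : a ≤ b)
    (hb : b < N) : G a - G (a + 1) ≤ G b - G (b + 1) := by
  induction b, hab using Nat.le_induction with
  | base => exact le_rfl
  | succ b hab ih =>
    have := h.conc b (by omega)
    have := ih (by omega)
    linarith

theorem tele (G : ℕ → ℝ) (a N : ℕ) (h : a ≤ N) :
    ∑ k ∈ Finset.range N, (if a ≤ k then G k - G (k + 1) else 0) = G a - G N := by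
  induction N, h using Nat.le_induction with
  | base =>
    rw [sub_self]
    refine Finset.sum_eq_zero fun k hk => ?_
    rw [if_neg (by simpa using hk)]
  | succ N hN ih =>
    rw [Finset.sum_range_succ, ih, if_pos hN]; ring

theorem tele_const (c : ℝ) (a N : ℕ) (h : a ≤ N) :
    ∑ k ∈ Finset.range N, (if a ≤ k then c else 0) = c * ((N : ℝ) - a) := by
  induction N, h using Nat.le_induction with
  | base =>
    rw [sub_self, mul_zero]
    refine Finset.sum_eq_zero fun k hk => ?_
    rw [if_neg (by simpa using hk)]
  | succ N hN ih =>
    rw [Finset.sum_range_succ, ih, if_pos hN]; push_cast; ring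

theorem comp_update {n : ℕ} (w : Fin n → ℕ → ℝ) (k : Fin n → ℕ) (i : Fin n) (a : ℕ) :
    (fun j => w j (Function.update k i a j)) = Function.update (fun j => w j (k j)) i (w i a) := by
  funext j
  by_cases h : j = i
  · subst h; simp
  · simp [Function.update_of_ne h]

/-- Lower bound on the revenue of the virtual value auction. -/
theorem lower {n : ℕ} (N : ℕ) (hN : 0 < N) (v G w : Fin n → ℕ → ℝ)
    (hG : ∀ i, Ironed N (v i) (G i)) (hv : ∀ i, Monotone (v i))
    (hvw : ∀ i, ∀ k < N, v i k ≤ w i k) :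
    ∑ k ∈ cube n N, VV (fun i a => G i a - G i (a + 1)) k ≤
      ∑ k ∈ cube n N, ∑ i,
        (myerson N v (fun i a => G i a - G i (a + 1))).pay (fun j => w j (k j)) i := by
  classical
  set φ : Fin n → ℕ → ℝ := fun i a => G i a - G i (a + 1) with hφdef
  have hφ : ∀ i, ∀ a b, a ≤ b → b < N → φ i a ≤ φ i b := fun i a b h1 h2 => (hG i).mono a b h1 h2
  calc ∑ k ∈ cube n N, VV φ k ≤ ∑ k ∈ cube n N, ∑ i, ZZ N v φ w i k := by
        refine Finset.sum_le_sum fun k hk => VV_le_ZZ N v φ w hφ hv hvw k ?_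
        simpa [cube, Fintype.mem_piFinset] using hk
    _ = ∑ i, ∑ k ∈ cube n N, ZZ N v φ w i k := Finset.sum_comm
    _ ≤ ∑ i, ∑ k ∈ cube n N, (myerson N v φ).pay (fun j => w j (k j)) i := by
        refine Finset.sum_le_sum fun i _ => sum_le_of_update n N hN i _ _ fun k _ => ?_
        simp only [ZZ, myerson, comp_update, lst_update, Function.update_self]
        rw [Finset.sum_comm]
        conv_rhs => rw [Finset.sum_comm]
        refine Finset.sum_le_sum fun a ha => ?_
        have haN := Finset.mem_range.1 ha
        by_cases hl : Lst N v φ i a (fun j => w j (k j))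
        swap
        · simp [hl]
        simp only [hl, true_and, if_true]
        have hcontact : G i a = v i a * ((N : ℝ) - a) := by
          rcases Nat.eq_zero_or_pos a with h0 | h0
          · subst h0; simpa using (hG i).first
          · obtain ⟨a', rfl⟩ : ∃ a', a = a' + 1 := ⟨a - 1, by omega⟩
            refine (hG i).contact a' (by omega) ?_
            have h1 := hl.2 a' (by omega)
            by_contra hcon
            exact h1 (hl.1.mono (Real.toNNReal_le_toNNReal (not_lt.1 hcon)))
        have hφv : φ i a ≤ v i a := by
          have h1 := (hG i).maj (a + 1) (by omega)
          have h2 : v i a ≤ v i (a + 1) := hv i (Nat.le_succ a)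
          have h3 : ((a : ℝ) + 1) ≤ N := by exact_mod_cast haN
          simp only [hφdef]
          push_cast at h1
          nlinarith
        have e1 := tele (G i) a N haN.le
        have e2 := tele_const (v i a) a N haN.le
        rw [(hG i).last, sub_zero, hcontact, ← e2] at e1
        have e3 : ∑ b ∈ Finset.range N, (if a ≤ b then φ i b else
            if v i a ≤ w i b then φ i a else 0) =
            ∑ b ∈ Finset.range N, (if a ≤ b then φ i b else 0) +
            ∑ b ∈ Finset.range N, (if a ≤ b then 0 else if v i a ≤ w i b then φ i a else 0) := by
          rw [← Finset.sum_add_distrib]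
          refine Finset.sum_congr rfl fun b _ => ?_
          split_ifs <;> simp
        rw [e3]
        simp only [hφdef] at e1 ⊢
        rw [e1, ← Finset.sum_add_distrib]
        refine Finset.sum_le_sum fun b hb => ?_
        by_cases hab : a ≤ b
        · have : v i a ≤ w i b := (hv i hab).trans (hvw i b (Finset.mem_range.1 hb))
          simp [hab, this]
        · simp only [hab, if_false, zero_add]
          split_ifs
          · exact hφv
          · exact le_rfl
    _ = _ := Finset.sum_comm

/-- Upper bound on the revenue of an arbitrary mechanism. -/
theorem upper {n : ℕ} (N s : ℕ) (hN : 0 < N) (H η : ℝ) (hH : 0 ≤ H) (hη : 0 ≤ η)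
    (v G w : Fin n → ℕ → ℝ)
    (hG : ∀ i, Ironed N (v i) (G i)) (hw : ∀ i, Monotone (w i))
    (hwH : ∀ i k, w i k ≤ H)
    (hwv : ∀ i, ∀ k, k + s < N → w i k ≤ v i (k + s) + η)
    (M : Mech n) (hM : DSIC M) (hM' : IR M) :
    ∑ k ∈ cube n N, ∑ i, M.pay (fun j => w j (k j)) i ≤
      ∑ k ∈ cube n N, (VV (fun i a => G i a - G i (a + 1)) k + (η + n * (s / N * H))) := by
  classical
  set φ : Fin n → ℕ → ℝ := fun i a => G i a - G i (a + 1) with hφdef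
  have hpayH : ∀ k : Fin n → ℕ, ∑ i, M.pay (fun j => w j (k j)) i ≤ H := by
    intro k
    calc _ ≤ ∑ i, H * M.alloc (fun j => w j (k j)) i := by
          refine Finset.sum_le_sum fun i _ => ?_
          have h1 := hM' i (fun j => w j (k j))
          have h2 := mul_le_mul_of_nonneg_right (hwH i (k i)) (M.alloc_nonneg (fun j => w j (k j)) i)
          simp only [util] at h1
          linarith
      _ ≤ H := by
          rw [← Finset.mul_sum]
          have := M.alloc_sum_le_one (fun j => w j (k j))
          nlinarith
  set A : (Fin n → ℕ) → Prop := fun k => ∀ i, k i + s < N with hA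
  have step1 : ∀ k, ∑ i, M.pay (fun j => w j (k j)) i ≤
      ∑ i, (if A k then M.pay (fun j => w j (k j)) i else 0) +
      ∑ i, (if N ≤ k i + s then H else 0) := by
    intro k
    by_cases h : A k
    · simp only [h, if_true]
      have : 0 ≤ ∑ i, (if N ≤ k i + s then H else 0) :=
        Finset.sum_nonneg fun i _ => by split_ifs <;> simp [hH]
      linarith
    · simp only [h, if_false, Finset.sum_const_zero, zero_add]
      simp only [hA] at h
      push Not at h
      obtain ⟨i, hi⟩ := h
      refine (hpayH k).trans ?_
      have := Finset.single_le_sum (f := fun i => if N ≤ k i + s then H else 0)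
        (fun i _ => by split_ifs <;> simp [hH]) (Finset.mem_univ i)
      simpa [hi] using this
  have step2 : ∀ i, ∑ k ∈ cube n N, (if N ≤ k i + s then H else 0) ≤
      ∑ k ∈ cube n N, (s / N * H) := by
    intro i
    refine sum_le_of_update n N hN i (fun k => if N ≤ k i + s then H else 0) (fun _ => s / N * H)
      fun k _ => ?_
    simp only [Function.update_self, Finset.sum_const, Finset.card_range, nsmul_eq_mul]
    have hNr : (N : ℝ) ≠ 0 := by positivity
    have e : (N : ℝ) * (s / N * H) = s * H := by field_simp
    rw [e, ← Finset.sum_filter, Finset.sum_const, nsmul_eq_mul]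
    refine mul_le_mul_of_nonneg_right ?_ hH
    have : (Finset.range N).filter (fun a => N ≤ a + s) ⊆ Finset.Ico (N - s) N := by
      intro a ha
      simp only [Finset.mem_filter, Finset.mem_range, Finset.mem_Ico] at ha ⊢
      omega
    have h2 := Finset.card_le_card this
    rw [Nat.card_Ico] at h2
    exact_mod_cast (by omega : _ ≤ s)
  have step3 : ∀ i, ∑ k ∈ cube n N, (if A k then M.pay (fun j => w j (k j)) i else 0) ≤
      ∑ k ∈ cube n N,
        (if A k then (φ i (k i + s) + η) * M.alloc (fun j => w j (k j)) i else 0) := by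
    intro i
    refine sum_le_of_update n N hN i
      (fun k => if A k then M.pay (fun j => w j (k j)) i else 0)
      (fun k => if A k then (φ i (k i + s) + η) * M.alloc (fun j => w j (k j)) i else 0)
      fun k _ => ?_
    have hAu : ∀ a, A (Function.update k i a) ↔ (∀ j, j ≠ i → k j + s < N) ∧ a + s < N := by
      intro a
      simp only [hA]
      constructor
      · intro h
        refine ⟨fun j hj => ?_, ?_⟩
        · simpa [Function.update_of_ne hj] using h j
        · simpa using h i
      · rintro ⟨h1, h2⟩ j
        by_cases hj : j = i
        · subst hj; simpa using h2
        · simpa [Function.update_of_ne hj] using h1 j hj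
    simp only [hAu, comp_update, Function.update_self]
    by_cases hB : ∀ j, j ≠ i → k j + s < N
    swap
    · simp [hB]
    have hB' : (∀ j, j ≠ i → k j + s < N) = True := eq_true hB
    simp only [hB', true_and]
    rw [← Finset.sum_filter, ← Finset.sum_filter]
    have hf : (Finset.range N).filter (fun a => a + s < N) = Finset.range (N - s) := by
      ext a
      simp only [Finset.mem_filter, Finset.mem_range]
      omega
    rw [hf]
    by_cases hs : s ≤ N
    swap
    · rw [Nat.sub_eq_zero_of_le (by omega)]; simp
    set b : Fin n → ℝ := fun j => w j (k j)
    have hIC : ∀ a c, w i a * M.alloc (Function.update b i (w i c)) i -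
        M.pay (Function.update b i (w i c)) i ≤ w i a * M.alloc (Function.update b i (w i a)) i -
        M.pay (Function.update b i (w i a)) i := by
      intro a c
      have := hM i (Function.update b i (w i a)) (w i c)
      simpa [util] using this
    refine one_bidder N (N - s) s (by omega) (v i) (w i)
      (fun a => M.alloc (Function.update b i (w i a)) i)
      (fun a => M.pay (Function.update b i (w i a)) i) (G i) η ?_ ?_ ?_ ?_ ?_ (hG i).maj (hG i).last
    · intro a ha; exact hwv i a (by omega)
    · have := hM' i (Function.update b i (w i 0))
      simp only [util, Function.update_self] at this
      linarith
    · intro a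
      have := hIC (a + 1) a
      linarith
    · exact M.alloc_nonneg _ _
    · intro a
      rcases (hw i (Nat.le_succ a)).eq_or_lt with h | h
      · simp only [Nat.succ_eq_add_one] at h
        rw [h]
      · have h1 := hIC (a + 1) a
        have h2 := hIC a (a + 1)
        simp only [Nat.succ_eq_add_one] at h
        by_contra hcon
        push Not at hcon
        nlinarith
  have step4 : ∀ k, ∑ i, (if A k then (φ i (k i + s) + η) * M.alloc (fun j => w j (k j)) i else 0)
      ≤ (if A k then VV φ (fun i => k i + s) else 0) + η := by
    intro k
    by_cases h : A k
    · simp only [h, if_true]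
      calc _ ≤ ∑ i, (VV φ (fun i => k i + s) + η) * M.alloc (fun j => w j (k j)) i := by
            refine Finset.sum_le_sum fun i _ => mul_le_mul_of_nonneg_right ?_ (M.alloc_nonneg _ _)
            have := le_VV φ (fun i => k i + s) i
            linarith
        _ ≤ _ := by
            rw [← Finset.mul_sum]
            have h1 := M.alloc_sum_le_one (fun j => w j (k j))
            have h2 := VV_nonneg φ (fun i => k i + s)
            nlinarith
    · simpa [h] using hη
  have step5 : ∑ k ∈ cube n N, (if A k then VV φ (fun i => k i + s) else 0) ≤
      ∑ k ∈ cube n N, VV φ k := by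
    rw [← Finset.sum_filter]
    rw [← Finset.sum_image (s := (cube n N).filter A) (g := fun (k : Fin n → ℕ) i => k i + s)
      (f := fun k => VV φ k)]
    · refine Finset.sum_le_sum_of_subset_of_nonneg ?_ fun k _ _ => VV_nonneg φ k
      intro k hk
      simp only [Finset.mem_image, Finset.mem_filter] at hk
      obtain ⟨k', ⟨-, h⟩, rfl⟩ := hk
      simpa [cube, Fintype.mem_piFinset] using h
    · intro k _ k' _ h
      funext i
      have := congrFun h i
      simp only at this
      omega
  calc _ ≤ ∑ k ∈ cube n N, (∑ i, (if A k then M.pay (fun j => w j (k j)) i else 0) +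
      ∑ i, (if N ≤ k i + s then H else 0)) := Finset.sum_le_sum fun k _ => step1 k
    _ = ∑ i, ∑ k ∈ cube n N, (if A k then M.pay (fun j => w j (k j)) i else 0) +
        ∑ i, ∑ k ∈ cube n N, (if N ≤ k i + s then H else 0) := by
        rw [Finset.sum_add_distrib, Finset.sum_comm, Finset.sum_comm (s := cube n N)]
    _ ≤ ∑ i, ∑ k ∈ cube n N,
        (if A k then (φ i (k i + s) + η) * M.alloc (fun j => w j (k j)) i else 0) +
        ∑ i : Fin n, ∑ k ∈ cube n N, (s / N * H) :=
        add_le_add (Finset.sum_le_sum fun i _ => step3 i) (Finset.sum_le_sum fun i _ => step2 i)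
    _ = ∑ k ∈ cube n N, (∑ i,
        (if A k then (φ i (k i + s) + η) * M.alloc (fun j => w j (k j)) i else 0)) +
        ∑ k ∈ cube n N, (n * (s / N * H)) := by
        rw [Finset.sum_comm, Finset.sum_comm (s := Finset.univ) (t := cube n N)]
        simp
    _ ≤ ∑ k ∈ cube n N, ((if A k then VV φ (fun i => k i + s) else 0) + η) +
        ∑ k ∈ cube n N, (n * (s / N * H)) :=
        add_le_add (Finset.sum_le_sum fun k _ => step4 k) le_rfl
    _ ≤ _ := by
        simp only [Finset.sum_add_distrib]
        linarith

open ProbabilityTheory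

/-- Quantile function of a distribution on `[0,H]`. -/
noncomputable def qf (μ : Measure ℝ) (H : ℝ) (t : ℝ) : ℝ :=
  sInf {x | (0 ≤ x ∧ x ≤ H) ∧ (t ≤ cdf μ x ∨ x = H)}

theorem qf_bdd (μ : Measure ℝ) (H t : ℝ) :
    BddBelow {x | (0 ≤ x ∧ x ≤ H) ∧ (t ≤ cdf μ x ∨ x = H)} := ⟨0, fun _ hx => hx.1.1⟩

theorem qf_memH (μ : Measure ℝ) (H t : ℝ) (hH : 0 < H) :
    H ∈ {x | (0 ≤ x ∧ x ≤ H) ∧ (t ≤ cdf μ x ∨ x = H)} := ⟨⟨hH.le, le_rfl⟩, Or.inr rfl⟩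

theorem qf_nonneg (μ : Measure ℝ) (H t : ℝ) (hH : 0 < H) : 0 ≤ qf μ H t :=
  le_csInf ⟨H, qf_memH μ H t hH⟩ fun _ hx => hx.1.1

theorem qf_le (μ : Measure ℝ) (H t : ℝ) (hH : 0 < H) : qf μ H t ≤ H :=
  csInf_le (qf_bdd μ H t) (qf_memH μ H t hH)

theorem qf_mono (μ : Measure ℝ) (H : ℝ) (hH : 0 < H) : Monotone (qf μ H) := by
  intro t t' h
  refine csInf_le_csInf (qf_bdd μ H t) ⟨H, qf_memH μ H t' hH⟩ ?_
  rintro x ⟨hx, hx'⟩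
  exact ⟨hx, hx'.imp (fun h' => h.trans h') id⟩

theorem qf_nonpos (μ : Measure ℝ) (H t : ℝ) (hH : 0 < H) (ht : t ≤ 0) : qf μ H t = 0 := by
  refine le_antisymm (csInf_le (qf_bdd μ H t) ⟨⟨le_rfl, hH.le⟩, Or.inl ?_⟩) (qf_nonneg μ H t hH)
  exact ht.trans (cdf_nonneg μ 0)

theorem cdf_neg (μ : Measure ℝ) [IsProbabilityMeasure μ] (H : ℝ) (hμ : μ (Icc 0 H) = 1)
    (x : ℝ) (hx : x < 0) : cdf μ x = 0 := by
  rw [cdf_eq_real, measureReal_def]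
  have h0 : μ (Icc 0 H)ᶜ = 0 := (prob_compl_eq_zero_iff measurableSet_Icc).2 hμ
  have : μ (Iic x) = 0 := by
    refine measure_mono_null ?_ h0
    intro y hy
    simp only [mem_compl_iff, mem_Icc, not_and_or]
    have h2 : y ≤ x := hy
    exact Or.inl (by linarith)
  simp [this]

theorem cdf_ge (μ : Measure ℝ) [IsProbabilityMeasure μ] (H : ℝ) (hμ : μ (Icc 0 H) = 1)
    (x : ℝ) (hx : H ≤ x) : cdf μ x = 1 := by
  rw [cdf_eq_real, measureReal_def]
  have : μ (Iic x) = 1 := le_antisymm prob_le_one (hμ ▸ measure_mono fun y hy => hy.2.trans hx)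
  simp [this]

theorem qf_galois (μ : Measure ℝ) [IsProbabilityMeasure μ] (H : ℝ) (hH : 0 < H)
    (hμ : μ (Icc 0 H) = 1) (t x : ℝ) (ht : 0 < t) (ht1 : t ≤ 1) :
    qf μ H t ≤ x ↔ t ≤ cdf μ x := by
  constructor
  · intro h
    rcases le_or_gt H x with hx | hx
    · rw [cdf_ge μ H hμ x hx]; exact ht1
    have hright : ContinuousWithinAt (cdf μ) (Ioi x) x :=
      ((cdf μ).right_continuous x).mono Ioi_subset_Ici_self
    refine ge_of_tendsto hright ?_
    filter_upwards [self_mem_nhdsWithin] with y hy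
    have hy' : qf μ H t < y := h.trans_lt hy
    obtain ⟨z, ⟨hz, hz'⟩, hzy⟩ := exists_lt_of_csInf_lt ⟨H, qf_memH μ H t hH⟩ hy'
    have : t ≤ cdf μ z := by
      rcases hz' with h1 | h1
      · exact h1
      · rw [cdf_ge μ H hμ z h1.ge]; exact ht1
    exact this.trans (monotone_cdf μ hzy.le)
  · intro h
    rcases lt_or_ge x 0 with hx | hx
    · rw [cdf_neg μ H hμ x hx] at h; linarith
    rcases le_or_gt H x with hx' | hx'
    · exact (qf_le μ H t hH).trans hx'
    · exact csInf_le (qf_bdd μ H t) ⟨⟨hx, hx'.le⟩, Or.inl h⟩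

/-- Uniform distribution. -/
noncomputable abbrev unif : Measure ℝ := volume.restrict (Ioo 0 1)

instance : IsProbabilityMeasure unif := ⟨by simp [unif]⟩

theorem clamp_sum (y : ℝ) (hy : 0 ≤ y) (m : ℕ) :
    ∑ k ∈ Finset.range m, max 0 (min 1 (y - k)) = min y m := by
  induction m with
  | zero => simp [hy]
  | succ m ih =>
    rw [Finset.sum_range_succ, ih]
    push_cast
    rcases le_total y m with h | h
    · rw [min_eq_left h, min_eq_right (by linarith), max_eq_left (by linarith),
        min_eq_left (by linarith)]
      ring
    · rcases le_total y (m + 1) with h' | h'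
      · rw [min_eq_right h, min_eq_right (by linarith), max_eq_right (by linarith),
          min_eq_left h']
        ring
      · rw [min_eq_right h, min_eq_left (by linarith), max_eq_right (by linarith),
          min_eq_right h']

theorem unif_Iic (c : ℝ) : unif (Iic c) = ENNReal.ofReal (max 0 (min 1 c)) := by
  rw [Measure.restrict_apply measurableSet_Iic]
  rcases lt_or_ge c 1 with h | h
  · have : Iic c ∩ Ioo 0 1 = Ioc 0 c := by
      ext x
      simp only [mem_inter_iff, mem_Iic, mem_Ioo, mem_Ioc]
      constructor
      · rintro ⟨h1, h2, h3⟩; exact ⟨h2, h1⟩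
      · rintro ⟨h1, h2⟩; exact ⟨h2, h1, by linarith⟩
    rw [this, Real.volume_Ioc, min_eq_right h.le]
    rcases le_total c 0 with h' | h'
    · rw [max_eq_left h', ENNReal.ofReal_of_nonpos (by linarith)]; simp
    · rw [max_eq_right h']; simp
  · have : Iic c ∩ Ioo 0 1 = Ioo 0 1 := by
      refine inter_eq_right.2 fun x hx => ?_
      exact hx.2.le.trans h
    rw [this, min_eq_left h]; simp

/-- The `k`-th of `N` quantile slices of `μ`. -/
noncomputable def slice (μ : Measure ℝ) (H : ℝ) (N k : ℕ) (r : ℝ) : ℝ := qf μ H ((k + r) / N)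

theorem meas_slice (μ : Measure ℝ) (H : ℝ) (hH : 0 < H) (N k : ℕ) :
    Measurable (slice μ H N k) := by
  refine (qf_mono μ H hH).measurable.comp ?_
  fun_prop

theorem decomp (μ : Measure ℝ) [IsProbabilityMeasure μ] (H : ℝ) (hH : 0 < H)
    (hμ : μ (Icc 0 H) = 1) (N : ℕ) (hN : 0 < N) :
    μ = ∑ k ∈ Finset.range N, (N : ENNReal)⁻¹ • unif.map (slice μ H N k) := by
  have hNr : (0 : ℝ) < N := by exact_mod_cast hN
  have hIic : ∀ x, (∑ k ∈ Finset.range N, (N : ENNReal)⁻¹ • unif.map (slice μ H N k)) (Iic x)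
      = μ (Iic x) := by
    intro x
    have h1 : ∀ k ∈ Finset.range N, (unif.map (slice μ H N k)) (Iic x) =
        ENNReal.ofReal (max 0 (min 1 (N * cdf μ x - k))) := by
      intro k hk
      have hkN : (k : ℝ) + 1 ≤ N := by exact_mod_cast Finset.mem_range.1 hk
      have hk0 : (0 : ℝ) ≤ k := by positivity
      rw [Measure.map_apply (meas_slice μ H hH N k) measurableSet_Iic, ← unif_Iic]
      refine measure_congr ?_
      have hae : ∀ᵐ r ∂unif, r ∈ Ioo (0 : ℝ) 1 := ae_restrict_mem measurableSet_Ioo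
      filter_upwards [hae] with r hr
      refine propext ?_
      change slice μ H N k r ≤ x ↔ r ≤ _
      have hr1 := hr.1
      have hr2 := hr.2
      rw [slice, qf_galois μ H hH hμ _ x (by positivity)
        (by rw [div_le_one hNr]; linarith), div_le_iff₀ hNr]
      constructor <;> intro h <;> linarith
    rw [Measure.finsetSum_apply]
    simp only [Measure.smul_apply, smul_eq_mul]
    rw [← Finset.mul_sum, Finset.sum_congr rfl h1, ← ENNReal.ofReal_sum_of_nonneg
      (fun _ _ => le_max_left _ _), clamp_sum _ (mul_nonneg hNr.le (cdf_nonneg μ x)),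
      min_eq_left (by nlinarith [cdf_le_one μ x]), ENNReal.ofReal_mul hNr.le, ofReal_cdf,
      ENNReal.ofReal_natCast, ← mul_assoc, ENNReal.inv_mul_cancel (by exact_mod_cast hN.ne')
      (ENNReal.natCast_ne_top N), one_mul]
  exact Measure.ext_of_Iic _ _ fun x => (hIic x).symm

theorem pi_decomp {n : ℕ} (μ : Fin n → Measure ℝ) [∀ i, IsProbabilityMeasure (μ i)] (H : ℝ)
    (hH : 0 < H) (hμ : ∀ i, μ i (Icc 0 H) = 1) (N : ℕ) (hN : 0 < N) :
    Measure.pi μ = ∑ k ∈ cube n N, ((N : ENNReal)⁻¹ ^ n) •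
      (Measure.pi fun _ : Fin n => unif).map (fun r i => slice (μ i) H N (k i) (r i)) := by
  have hm := fun (k : Fin n → ℕ) i => meas_slice (μ i) H hH N (k i)
  refine Measure.pi_eq fun s hs => ?_
  rw [Measure.finsetSum_apply]
  have e : ∀ k : Fin n → ℕ, ((Measure.pi fun _ : Fin n => unif).map
      (fun r i => slice (μ i) H N (k i) (r i))) (univ.pi s) =
      ∏ i, (unif.map (slice (μ i) H N (k i))) (s i) := by
    intro k
    have hp : ∀ i, IsProbabilityMeasure (unif.map (slice (μ i) H N (k i))) := fun i =>
      Measure.isProbabilityMeasure_map (hm k i).aemeasurable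
    rw [Measure.pi_map_pi (μ := fun _ : Fin n => unif) (fun i => (hm k i).aemeasurable), Measure.pi_pi]
  simp only [Measure.smul_apply, e, smul_eq_mul]
  conv_rhs =>
    enter [2, i]
    rw [decomp (μ i) H hH (hμ i) N hN, Measure.finsetSum_apply]
  rw [Finset.prod_univ_sum]
  refine Finset.sum_congr rfl fun k _ => ?_
  simp [Finset.prod_mul_distrib]

/-- Comparison of integrals slice by slice. -/
theorem integral_compare {n : ℕ} (μ : Fin n → Measure ℝ) [∀ i, IsProbabilityMeasure (μ i)] (H : ℝ)
    (hH : 0 < H) (hμ : ∀ i, μ i (Icc 0 H) = 1) (N : ℕ) (hN : 0 < N)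
    (f g : (Fin n → ℝ) → ℝ) (C : ℝ) (hf : Integrable f (Measure.pi μ))
    (hg : Integrable g (Measure.pi μ))
    (h : ∀ r : Fin n → ℝ, (∀ i, r i ∈ Ioo (0 : ℝ) 1) →
      ∑ k ∈ cube n N, f (fun i => slice (μ i) H N (k i) (r i)) ≤
      ∑ k ∈ cube n N, (g (fun i => slice (μ i) H N (k i) (r i)) + C)) :
    ∫ b, f b ∂(Measure.pi μ) ≤ ∫ b, g b ∂(Measure.pi μ) + C := by
  have hgm : ∀ k : Fin n → ℕ, Measurable fun (r : Fin n → ℝ) i => slice (μ i) H N (k i) (r i) :=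
    fun k => measurable_pi_lambda _ fun i => (meas_slice (μ i) H hH N (k i)).comp
      (measurable_pi_apply i)
  have hc0 : ((N : ENNReal)⁻¹ ^ n) ≠ 0 := by simp
  have hct : ((N : ENNReal)⁻¹ ^ n) ≠ ⊤ :=
    ENNReal.pow_ne_top (ENNReal.inv_ne_top.2 (by exact_mod_cast hN.ne'))
  have main : ∀ F : (Fin n → ℝ) → ℝ, Integrable F (Measure.pi μ) →
      (∀ k ∈ cube n N, Integrable (fun r => F (fun i => slice (μ i) H N (k i) (r i)))
        (Measure.pi fun _ : Fin n => unif)) ∧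
      ∫ b, F b ∂(Measure.pi μ) = ((N : ENNReal)⁻¹ ^ n).toReal *
        ∫ r, ∑ k ∈ cube n N, F (fun i => slice (μ i) H N (k i) (r i))
          ∂(Measure.pi fun _ : Fin n => unif) := by
    intro F hF
    have hF' := hF
    rw [pi_decomp μ H hH hμ N hN, integrable_finsetSum_measure] at hF'
    have h1 : ∀ k ∈ cube n N, Integrable F ((Measure.pi fun _ : Fin n => unif).map
        (fun r i => slice (μ i) H N (k i) (r i))) := fun k hk =>
      (integrable_smul_measure hc0 hct).1 (hF' k hk)
    have h2 : ∀ k ∈ cube n N, Integrable (fun r => F (fun i => slice (μ i) H N (k i) (r i)))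
        (Measure.pi fun _ : Fin n => unif) := fun k hk =>
      (integrable_map_measure (h1 k hk).1 (hgm k).aemeasurable).1 (h1 k hk)
    refine ⟨h2, ?_⟩
    conv_lhs => rw [pi_decomp μ H hH hμ N hN]
    rw [integral_finsetSum_measure hF', integral_finsetSum _ h2, Finset.mul_sum]
    refine Finset.sum_congr rfl fun k hk => ?_
    rw [integral_smul_measure, integral_map (hgm k).aemeasurable (h1 k hk).1, smul_eq_mul]
  obtain ⟨hf1, hf2⟩ := main f hf
  obtain ⟨hg1, hg2⟩ := main (fun b => g b + C) (hg.add (integrable_const C))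
  have hgC : ∫ b, (g b + C) ∂(Measure.pi μ) = ∫ b, g b ∂(Measure.pi μ) + C := by
    rw [integral_add hg (integrable_const C)]; simp
  rw [← hgC, hf2, hg2]
  refine mul_le_mul_of_nonneg_left ?_ ENNReal.toReal_nonneg
  refine integral_mono_ae (integrable_finsetSum _ hf1) (integrable_finsetSum _ hg1) ?_
  have hae : ∀ᵐ r ∂(Measure.pi fun _ : Fin n => unif), ∀ i, r i ∈ Ioo (0 : ℝ) 1 := by
    rw [ae_all_iff]
    intro i
    exact (Measure.tendsto_eval_ae_ae (μ := fun _ : Fin n => unif) (i := i)).eventually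
      (ae_restrict_mem measurableSet_Ioo)
  filter_upwards [hae] with r hr
  exact h r hr

/-- Conservative model values. -/
noncomputable def low (μ : Measure ℝ) (H ε : ℝ) (N k : ℕ) : ℝ :=
  max 0 (qf μ H ((k : ℝ) / N - ε) - ε)

theorem low_mono (μ : Measure ℝ) (H ε : ℝ) (hH : 0 < H) (N : ℕ) : Monotone (low μ H ε N) := by
  intro k k' h
  have : (k : ℝ) / N - ε ≤ (k' : ℝ) / N - ε := by gcongr
  exact max_le_max le_rfl (by linarith [qf_mono μ H hH this])

theorem low_le_slice (P Q : Measure ℝ) [IsProbabilityMeasure P] [IsProbabilityMeasure Q]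
    (H ε : ℝ) (hH : 0 < H) (hε : 0 < ε) (hP : P (Icc 0 H) = 1) (hQ : Q (Icc 0 H) = 1)
    (hL : LevyLe P Q ε) (N : ℕ) (hN : 0 < N) (r : ℝ) (hr : r ∈ Ioo (0 : ℝ) 1)
    (k : ℕ) (hk : k < N) : low P H ε N k ≤ slice Q H N k r := by
  have hNr : (0 : ℝ) < N := by exact_mod_cast hN
  have hkN : (k : ℝ) + 1 ≤ N := by exact_mod_cast hk
  have hr1 := hr.1
  have hr2 := hr.2
  have h0 : 0 ≤ slice Q H N k r := qf_nonneg _ _ _ hH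
  refine max_le h0 ?_
  have h1 := (qf_galois Q H hH hQ ((k + r) / N) (slice Q H N k r) (by positivity)
    (by rw [div_le_one hNr]; linarith)).1 le_rfl
  have h2 := (hL (slice Q H N k r)).2
  change Q.real _ ≤ P.real _ + ε at h2
  rw [← cdf_eq_real, ← cdf_eq_real] at h2
  have h3 : (k : ℝ) / N ≤ (k + r) / N := by gcongr; linarith
  rcases le_or_gt ((k : ℝ) / N - ε) 0 with h | h
  · rw [qf_nonpos P H _ hH h]; linarith
  · have h4 : (k : ℝ) / N ≤ 1 := by rw [div_le_one hNr]; linarith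
    have := (qf_galois P H hH hP ((k : ℝ) / N - ε) (slice Q H N k r + ε) h (by linarith)).2
      (by linarith)
    linarith

theorem slice_le_low (P Q : Measure ℝ) [IsProbabilityMeasure P] [IsProbabilityMeasure Q]
    (H ε : ℝ) (hH : 0 < H) (hε : 0 < ε) (hP : P (Icc 0 H) = 1) (hQ : Q (Icc 0 H) = 1)
    (hL : LevyLe P Q ε) (N s : ℕ) (hN : 0 < N) (hs : 1 + 2 * ε * N ≤ s)
    (r : ℝ) (hr : r ∈ Ioo (0 : ℝ) 1)
    (k : ℕ) (hk : k + s < N) : slice Q H N k r ≤ low P H ε N (k + s) + 2 * ε := by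
  have hNr : (0 : ℝ) < N := by exact_mod_cast hN
  have hkN : (k : ℝ) + s ≤ N := by exact_mod_cast hk.le
  have hk0 : (0 : ℝ) ≤ k := by positivity
  have hr1 := hr.1
  have hr2 := hr.2
  have hεN : 0 < ε * N := by positivity
  set T : ℝ := ((k + s : ℕ) : ℝ) / N - ε with hT
  have hT' : (k + r) / N ≤ T - ε := by
    rw [hT]
    have : ((k + s : ℕ) : ℝ) / N - ε - ε = (k + s - 2 * ε * N) / N := by
      push_cast; field_simp; ring
    rw [this]
    gcongr
    linarith
  have hp : 0 < (k + r) / N := by positivity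
  have hT1 : T ≤ 1 := by
    have : ((k + s : ℕ) : ℝ) / N ≤ 1 := by rw [div_le_one hNr]; push_cast; exact hkN
    linarith
  have h1 := (qf_galois P H hH hP T (qf P H T) (by linarith) hT1).1 le_rfl
  have h2 := (hL (qf P H T + ε)).1
  rw [add_sub_cancel_right] at h2
  change P.real _ - ε ≤ Q.real _ at h2
  rw [← cdf_eq_real, ← cdf_eq_real] at h2
  have h3 : slice Q H N k r ≤ qf P H T + ε :=
    (qf_galois Q H hH hQ ((k + r) / N) _ hp (by linarith)).2 (by linarith)
  have h4 : qf P H T - ε ≤ low P H ε N (k + s) := le_max_right _ _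
  linarith

end Robust


/-- Lévy-robustness for single-item auctions: given model distributions
`D i` supported on `[0,H]`, there is a single DSIC and IR mechanism `M`, depending only on
`D` and `ε`, whose revenue under any true distributions `D̂ i` within Lévy distance `ε` of the
`D i` is at least `OPT(D̂) − (6nH + 3nε + 2)·ε`. -/
theorem stmt0 (n : ℕ) (H ε : ℝ) (hH : 0 < H) (hε : 0 < ε)
    (D : Fin n → Measure ℝ)
    (hDprob : ∀ i, IsProbabilityMeasure (D i))
    (hDsupp : ∀ i, D i (Icc 0 H) = 1) :
    ∃ M : Mech n, DSIC M ∧ IR M ∧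
      ∀ Dhat : Fin n → Measure ℝ,
        (∀ i, IsProbabilityMeasure (Dhat i)) →
        (∀ i, Dhat i (Icc 0 H) = 1) →
        (∀ i, LevyLe (D i) (Dhat i) ε) →
        OPT (Measure.pi Dhat) - (6 * n * H + 3 * n * ε + 2) * ε ≤
          Rev M (Measure.pi Dhat) := by
  classical
  obtain ⟨N, hN⟩ := exists_nat_gt (1 / ε)
  have hNr : (0 : ℝ) < N := lt_trans (by positivity) hN
  have hN0 : 0 < N := by exact_mod_cast hNr
  have hNε : 1 ≤ ε * N := by
    have := (div_lt_iff₀ hε).1 hN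
    linarith
  set s : ℕ := ⌈1 + 2 * ε * N⌉₊ with hs
  have hs1 : 1 + 2 * ε * N ≤ s := Nat.le_ceil _
  have hs2 : (s : ℝ) ≤ 1 + 2 * ε * N + 1 := (Nat.ceil_lt_add_one (by positivity)).le
  have hsN : (s : ℝ) / N ≤ 6 * ε := by
    rw [div_le_iff₀ hNr]
    linarith
  set v : Fin n → ℕ → ℝ := fun i => Robust.low (D i) H ε N with hv
  have hv0 : ∀ i k, 0 ≤ v i k := fun i k => le_max_left _ _
  have hvH : ∀ i k, v i k ≤ H := fun i k =>
    max_le hH.le (by linarith [Robust.qf_le (D i) H ((k : ℝ) / N - ε) hH])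
  have hvm : ∀ i, Monotone (v i) := fun i => Robust.low_mono (D i) H ε hH N
  have hex : ∀ i, ∃ G : ℕ → ℝ, Robust.Ironed N (v i) G := by
    intro i
    obtain ⟨G, h1, h2, h3, h4, h5⟩ := Robust.iron N (v i) H (hv0 i) (hvH i)
    exact ⟨G, h1, h2, h3, h4, h5⟩
  choose G hG using hex
  set M : Mech n := Robust.myerson N v (fun i a => G i a - G i (a + 1)) with hM
  have hpay0 : ∀ b i, 0 ≤ M.pay b i := by
    intro b i
    simp only [hM, Robust.myerson]
    refine Finset.sum_nonneg fun a _ => ?_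
    split_ifs
    · exact hv0 i a
    · exact le_rfl
  have hpayB : ∀ b i, M.pay b i ≤ N * H := by
    intro b i
    simp only [hM, Robust.myerson]
    refine (Finset.sum_le_sum (g := fun _ => H) fun a _ => ?_).trans (by simp)
    split_ifs
    · exact hvH i a
    · exact hH.le
  refine ⟨M, Robust.myerson_DSIC _ _ _, Robust.myerson_IR _ _ _, ?_⟩
  intro Dhat hprob hsupp hlevy
  have hmeas : ∀ M' : Mech n, Measurable fun b => ∑ i, M'.pay b i := fun M' =>
    Finset.measurable_sum _ fun i _ => M'.meas_pay i
  have hMint : Integrable (fun b => ∑ i, M.pay b i) (Measure.pi Dhat) := by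
    refine Integrable.of_bound (hmeas M).aestronglyMeasurable (n * (N * H)) ?_
    refine Filter.Eventually.of_forall fun b => ?_
    rw [Real.norm_of_nonneg (Finset.sum_nonneg fun i _ => hpay0 b i)]
    refine (Finset.sum_le_sum fun i _ => hpayB b i).trans (by simp)
  have hRev0 : 0 ≤ Rev M (Measure.pi Dhat) :=
    integral_nonneg fun b => Finset.sum_nonneg fun i _ => hpay0 b i
  have hCpos : 0 ≤ (6 * n * H + 3 * n * ε + 2) * ε := by positivity
  rw [sub_le_iff_le_add]
  refine csSup_le ⟨_, M, Robust.myerson_DSIC _ _ _, Robust.myerson_IR _ _ _, rfl⟩ ?_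
  rintro _ ⟨M', hD', hI', rfl⟩
  by_cases hInt : Integrable (fun b => ∑ i, M'.pay b i) (Measure.pi Dhat)
  swap
  · rw [Rev, integral_undef hInt]
    linarith
  refine (Robust.integral_compare Dhat H hH hsupp N hN0 _ (fun b => ∑ i, M.pay b i)
    (2 * ε + n * (s / N * H)) hInt hMint ?_).trans ?_
  · intro r hr
    have hup := Robust.upper N s hN0 H (2 * ε) hH.le (by positivity) v G
      (fun i k => Robust.slice (Dhat i) H N k (r i)) hG
      (fun i k k' h => Robust.qf_mono (Dhat i) H hH (by gcongr))
      (fun i k => Robust.qf_le (Dhat i) H _ hH)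
      (fun i k hk => Robust.slice_le_low (D i) (Dhat i) H ε hH hε (hDsupp i) (hsupp i) (hlevy i)
        N s hN0 hs1 (r i) (hr i) k hk) M' hD' hI'
    have hlo := Robust.lower N hN0 v G (fun i k => Robust.slice (Dhat i) H N k (r i)) hG hvm
      (fun i k hk => Robust.low_le_slice (D i) (Dhat i) H ε hH hε (hDsupp i) (hsupp i) (hlevy i)
        N hN0 (r i) (hr i) k hk)
    rw [Finset.sum_add_distrib] at hup ⊢
    linarith
  · change Rev M _ + _ ≤ _
    have h1 : (n : ℝ) * (s / N * H) ≤ n * (6 * ε * H) := by gcongr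
    have h2 : 0 ≤ 3 * (n : ℝ) * ε * ε := by positivity
    nlinarith
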